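/- Bound on the mismatch between the error set and the importance set: Let E ⊆ {1,…,n} with |E| = k', let E₁ ⊆ E, let C > 1, and suppose FCP(E₁, C) holds for H. Let x^r = 1_E and let x^p ∈ K(H) satisfy ‖x^p − x^r‖₁ ≤ ‖x^r‖₁. Let L ⊆ {1,…,n} with |L| = k' satisfy |x^r_i − x^p_i| ≥ |x^r_{i'} − x^p_{i'}| for all i ∈ L and i' ∉ L. Then the symmetric difference satisfies |(L ∖ E) ∪ (E ∖ L)| ≤ 4·((C+1)/(C−1))·(k' − |E₁|). -/

import Mathlib

open Finset

/-- The fundamental cone `K(H)` of a binary parity-check matrix `H`. -/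
def fundCone {m n : ℕ} (H : Fin m → Fin n → Bool) : Set (Fin n → ℝ) :=
  {ω | (∀ i, 0 ≤ ω i) ∧
    ∀ j : Fin m, ∀ i, H j i = true →
      ω i ≤ ∑ i' ∈ (Finset.univ.filter fun i' => H j i' = true).erase i, ω i'}

/-- The fundamental cone property `FCP(S, C)`. -/
def FCP {m n : ℕ} (H : Fin m → Fin n → Bool) (S : Finset (Fin n)) (C : ℝ) : Prop :=
  ∀ ω ∈ fundCone H, ω ≠ 0 → C * ∑ i ∈ S, |ω i| < ∑ i ∈ Sᶜ, |ω i|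

/-- The indicator vector of a set `E` of bit positions. -/
def indic {n : ℕ} (E : Finset (Fin n)) : Fin n → ℝ := fun i => if i ∈ E then 1 else 0

theorem sum_indic {n : ℕ} (E S : Finset (Fin n)) : ∑ i ∈ S, indic E i = ((S ∩ E).card : ℝ) := by
  simp [indic, Finset.sum_ite_mem]

/-- A vector satisfying `FCP(E₁, C)` that is no farther from `1_E` than the origin has small
`ℓ1` norm. -/
theorem sum_le_of_FCP {m n : ℕ} {H : Fin m → Fin n → Bool} {E E₁ : Finset (Fin n)}
    (hE₁ : E₁ ⊆ E) {C : ℝ} (hC : 1 < C) (hFCP : FCP H E₁ C) {x : Fin n → ℝ}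
    (hx : x ∈ fundCone H) (hobj : ∑ i, |x i - indic E i| ≤ ∑ i, |indic E i|) :
    ∑ i, x i ≤ 2 * ((C + 1) / (C - 1)) * ((E.card : ℝ) - E₁.card) := by
  have habs : ∀ S : Finset (Fin n), ∑ i ∈ S, |x i| = ∑ i ∈ S, x i := fun S =>
    Finset.sum_congr rfl fun i _ => abs_of_nonneg (hx.1 i)
  have hcone : C * ∑ i ∈ E₁, x i ≤ ∑ i ∈ E₁ᶜ, x i := by
    by_cases h0 : x = 0
    · simp [h0]
    · simpa only [habs] using (hFCP x hx h0).le
  have hE : ∑ i, |indic E i| = (E.card : ℝ) := by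
    have h : ∀ i, |indic E i| = indic E i := fun i =>
      abs_of_nonneg (by unfold indic; split_ifs <;> norm_num)
    simp only [h, sum_indic, Finset.univ_inter]
  have hsum : ∑ i ∈ E₁, indic E i = (E₁.card : ℝ) := by
    rw [sum_indic, Finset.inter_eq_left.2 hE₁]
  have hin : (E₁.card : ℝ) - ∑ i ∈ E₁, x i ≤ ∑ i ∈ E₁, |x i - indic E i| := by
    rw [← hsum, ← Finset.sum_sub_distrib]
    exact Finset.sum_le_sum fun i _ => by linarith [neg_abs_le (x i - indic E i)]
  have hout : ∑ i ∈ E₁ᶜ, x i - ((E.card : ℝ) - E₁.card) ≤ ∑ i ∈ E₁ᶜ, |x i - indic E i| := by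
    have hsplit := Finset.sum_add_sum_compl E₁ (indic E)
    rw [hsum, sum_indic E univ, Finset.univ_inter] at hsplit
    rw [← hsplit, add_sub_cancel_left, ← Finset.sum_sub_distrib]
    exact Finset.sum_le_sum fun i _ => le_abs_self _
  have hbound : ∑ i ∈ E₁ᶜ, x i ≤ ∑ i ∈ E₁, x i + 2 * ((E.card : ℝ) - E₁.card) := by
    rw [hE, ← Finset.sum_add_sum_compl E₁] at hobj
    linarith
  have hC' : 0 < C - 1 := sub_pos.2 hC
  rw [← Finset.sum_add_sum_compl E₁, mul_div_assoc', div_mul_eq_mul_div, le_div_iff₀ hC']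
  nlinarith

/-- If `L` consists of the `|E|` positions where `x` differs most from `1_E`, then `|E \ L|` is at
most the sum of the entries of `x`. -/
theorem card_sdiff_le_sum {n : ℕ} {E L : Finset (Fin n)} {x : Fin n → ℝ} (hx : ∀ i, 0 ≤ x i)
    (hcard : (L \ E).card = (E \ L).card)
    (hL : ∀ i ∈ L, ∀ i' ∉ L, |indic E i' - x i'| ≤ |indic E i - x i|) :
    ((E \ L).card : ℝ) ≤ ∑ i, x i := by
  rcases (L \ E).eq_empty_or_nonempty with h | h
  · rw [← hcard, h]
    simpa using Finset.sum_nonneg fun i _ => hx i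
  obtain ⟨a, ha, hmin⟩ := Finset.exists_min_image _ x h
  have hLE : ((L \ E).card : ℝ) * x a ≤ ∑ i ∈ L \ E, x i := by
    simpa using Finset.card_nsmul_le_sum _ _ _ hmin
  have hEL : ((E \ L).card : ℝ) * (1 - x a) ≤ ∑ i ∈ E \ L, x i := by
    rw [← nsmul_eq_mul]
    refine Finset.card_nsmul_le_sum _ _ _ fun i hi => ?_
    rw [Finset.mem_sdiff] at ha hi
    have hai := hL a ha.1 i hi.2
    simp only [indic, hi.1, ha.2, if_true, if_false, zero_sub, abs_neg,
      abs_of_nonneg (hx a)] at hai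
    linarith [le_abs_self (1 - x i)]
  have hsub : ∑ i ∈ L \ E ∪ E \ L, x i ≤ ∑ i, x i :=
    Finset.sum_le_univ_sum_of_nonneg hx
  rw [Finset.sum_union disjoint_sdiff_sdiff] at hsub
  rw [hcard] at hLE
  linarith

/-- Bound on the mismatch between the error set and the importance set. -/
theorem importance_set_symmDiff_bound {m n : ℕ} (H : Fin m → Fin n → Bool)
    (E E₁ : Finset (Fin n)) (hE₁ : E₁ ⊆ E)
    (C : ℝ) (hC : 1 < C) (hFCP : FCP H E₁ C)
    (xp : Fin n → ℝ) (hxp : xp ∈ fundCone H)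
    (hobj : ∑ i, |xp i - indic E i| ≤ ∑ i, |indic E i|)
    (L : Finset (Fin n)) (hLcard : L.card = E.card)
    (hL : ∀ i ∈ L, ∀ i' ∉ L, |indic E i' - xp i'| ≤ |indic E i - xp i|) :
    ((((L \ E) ∪ (E \ L)).card : ℝ)) ≤
      4 * ((C + 1) / (C - 1)) * ((E.card : ℝ) - E₁.card) := by
  have hcard : (L \ E).card = (E \ L).card := Finset.card_sdiff_comm hLcard
  have hmass := (card_sdiff_le_sum hxp.1 hcard hL).trans (sum_le_of_FCP hE₁ hC hFCP hxp hobj)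
  rw [Finset.card_union_of_disjoint disjoint_sdiff_sdiff, hcard]
  push_cast
  linarith
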